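/- Let φ : (0,∞) → (0,∞) be C¹-smooth with φ' > 0. If Mⁿ ⊂ ℝ^{n+1} is a closed, smooth, strictly convex hypersurface with support function h > 0 and Gauss curvature 𝒦 satisfying φ(h) 𝒦 = 1 on 𝕊ⁿ, then Mⁿ is a rescaling of 𝕊ⁿ. In particular, the smooth isotropic Orlicz–Minkowski problem has only origin-centred spheres as solutions. -/

import Mathlib

/-!
We work with the unit sphere `𝕊ⁿ = sphere 0 1 ⊆ ℝ^{n+1}`.  A `C²` function `u` on `𝕊ⁿ` is
represented by its positively 1-homogeneous extension `u : ℝ^{n+1} → ℝ` (which is `C²` away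
from the origin).  For such an extension, the ambient Euclidean Hessian `D²u(x)` at a point
`x ∈ 𝕊ⁿ` annihilates the radial direction `x` and its restriction to the tangent space
`x^⊥ = T_x𝕊ⁿ` coincides with the spherical bilinear form `∇̄²u + ḡ u`.  Consequently:

* the eigenvalues of `∇̄²u + ḡ u` w.r.t. `ḡ` are the eigenvalues of the ambient Hessian
  matrix other than the trivial zero radial one, so for `0 ≤ k ≤ n` the elementary symmetric
  function `σ_k(∇̄²u + ḡ u, ḡ)` equals the `k`-th elementary symmetric function of all the
  eigenvalues of the ambient Hessian matrix, which is `(-1)^k` times the coefficient of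
  `t^{n+1-k}` in its characteristic polynomial (`sigmaElem` below);
* the spherical gradient `Du(x)` is the tangential part `∇u(x) - u(x)x` of the ambient
  gradient (`sphGrad` below);
* `u` is convex (resp. the hypersurface with support function `u` is strictly convex) iff the
  Hessian form is positive semidefinite (resp. positive definite on `x^⊥`) at every `x ∈ 𝕊ⁿ`.

The spherical Lebesgue measure `μ` is the `n`-dimensional Hausdorff measure `μH[n]`.
-/

open MeasureTheory Metric
open scoped RealInnerProductSpace

noncomputable section

/-- The ambient Euclidean space `ℝ^{n+1}`. -/
abbrev Esp (n : ℕ) := EuclideanSpace ℝ (Fin (n + 1))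

/-- The ambient Hessian bilinear form `D²u(x)(v,w)` of `u : ℝ^{n+1} → ℝ`. -/
def hessForm (n : ℕ) (u : Esp n → ℝ) (x v w : Esp n) : ℝ :=
  fderiv ℝ (fun y => fderiv ℝ u y w) x v

/-- The ambient Hessian matrix of `u` at `x` in the standard orthonormal coordinates. -/
def hessMatrix (n : ℕ) (u : Esp n → ℝ) (x : Esp n) : Matrix (Fin (n + 1)) (Fin (n + 1)) ℝ :=
  Matrix.of fun i j => hessForm n u x (EuclideanSpace.single i 1) (EuclideanSpace.single j 1)

/-- For a positively 1-homogeneous `u` and `x ∈ 𝕊ⁿ`, `k ≤ n`, this is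
`σ_k(∇̄²u + ḡ u, ḡ)(x)`, the `k`-th elementary symmetric function of the eigenvalues of
`∇̄²u + ḡ u` w.r.t. `ḡ`, computed from the characteristic polynomial of the ambient Hessian. -/
def sigmaElem (n k : ℕ) (u : Esp n → ℝ) (x : Esp n) : ℝ :=
  (-1 : ℝ) ^ k * ((hessMatrix n u x).charpoly.coeff (n + 1 - k))

/-- The spherical gradient `Du(x)` at `x ∈ 𝕊ⁿ`: the tangential part of the ambient gradient. -/
def sphGrad (n : ℕ) (u : Esp n → ℝ) (x : Esp n) : Esp n :=
  gradient u x - u x • x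

/-- `u` is positively 1-homogeneous (i.e. it is the canonical extension of `u|_{𝕊ⁿ}`). -/
def PosHom (n : ℕ) (u : Esp n → ℝ) : Prop :=
  ∀ r : ℝ, 0 < r → ∀ x : Esp n, u (r • x) = r * u x

/-- The spherical Lebesgue measure on `ℝ^{n+1}` (to be restricted to `𝕊ⁿ`):
the `n`-dimensional Hausdorff measure. -/
def sphMeasure (n : ℕ) : Measure (Esp n) := μH[(n : ℝ)]

open Polynomial in
lemma det_rankone {m : ℕ} (A : Matrix (Fin (m+1)) (Fin (m+1)) ℝ) (b x : Fin (m+1) → ℝ)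
    (hA : Matrix.vecMul x A = 0) (hb : x ⬝ᵥ b ≠ 0) :
    (A + Matrix.vecMulVec b x).det = (x ⬝ᵥ b) * ((-1) ^ m * A.charpoly.coeff 1) := by
  have key : ∀ s : ℝ, s ^ (m+1) * (A + Matrix.vecMulVec b x).charpoly.eval s
      = (Matrix.vecMulVec b x).charpoly.eval s * A.charpoly.eval s := by
    intro s
    rw [Matrix.eval_charpoly, Matrix.eval_charpoly, Matrix.eval_charpoly, ← Matrix.det_mul]
    have : (Matrix.scalar (Fin (m+1)) s - Matrix.vecMulVec b x) * (Matrix.scalar (Fin (m+1)) s - A)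
        = s • (Matrix.scalar (Fin (m+1)) s - (A + Matrix.vecMulVec b x)) := by
      have h0 : Matrix.vecMulVec b x * A = 0 := by
        rw [Matrix.vecMulVec_mul, hA]; ext i j; simp [Matrix.vecMulVec]
      have hs : Matrix.scalar (Fin (m+1)) s = s • (1 : Matrix (Fin (m+1)) (Fin (m+1)) ℝ) := by
        ext i j; simp [Matrix.smul_apply, Matrix.one_apply, Matrix.diagonal_apply]
      rw [hs, sub_mul, mul_sub, mul_sub, h0]
      simp only [smul_mul_assoc, one_mul, mul_smul_comm, mul_one, sub_zero, smul_sub, smul_add]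
      abel
    rw [this, Matrix.det_smul, Fintype.card_fin]
  have hpoly : X ^ (m+1) * (A + Matrix.vecMulVec b x).charpoly
      = (Matrix.vecMulVec b x).charpoly * A.charpoly := by
    apply Polynomial.funext
    intro s
    simpa using key s
  have h2 : (Matrix.vecMulVec b x).charpoly = X ^ m * (X - C (x ⬝ᵥ b)) := by
    rw [Matrix.charpoly_vecMulVec]
    rw [dotProduct_comm b x, Polynomial.smul_eq_C_mul]
    simp only [Fintype.card_fin, Nat.add_sub_cancel]
    ring
  have h3 : X * (A + Matrix.vecMulVec b x).charpoly = (X - C (x ⬝ᵥ b)) * A.charpoly := by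
    have : (X : ℝ[X]) ^ m ≠ 0 := pow_ne_zero _ X_ne_zero
    apply mul_left_cancel₀ this
    rw [← mul_assoc, ← pow_succ, hpoly, h2, mul_assoc]
  have c0 := congrArg (fun p => p.coeff 0) h3
  have c1 := congrArg (fun p => p.coeff 1) h3
  simp [sub_mul, hb] at c0
  simp [sub_mul, coeff_X_mul] at c1
  rw [Matrix.det_eq_sign_charpoly_coeff, c1, Fintype.card_fin, c0, pow_succ]
  ring

section Calc
variable {n : ℕ} {h : Esp n → ℝ}

lemma cd_at (hsm : ContDiffOn ℝ (⊤ : ℕ∞) h {(0 : Esp n)}ᶜ) {x : Esp n} (hx : x ≠ 0) :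
    ContDiffAt ℝ (⊤ : ℕ∞) h x :=
  hsm.contDiffAt (isOpen_compl_singleton.mem_nhds hx)

lemma diff_at (hsm : ContDiffOn ℝ (⊤ : ℕ∞) h {(0 : Esp n)}ᶜ) {x : Esp n} (hx : x ≠ 0) :
    DifferentiableAt ℝ h x :=
  (cd_at hsm hx).differentiableAt (by simp)

lemma fd_cd_at (hsm : ContDiffOn ℝ (⊤ : ℕ∞) h {(0 : Esp n)}ᶜ) {x : Esp n} (hx : x ≠ 0) :
    ContDiffAt ℝ 1 (fderiv ℝ h) x :=
  (cd_at hsm hx).fderiv_right (m := 1) (by norm_num; exact WithTop.coe_le_coe.2 le_top)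

lemma fd_diff_at (hsm : ContDiffOn ℝ (⊤ : ℕ∞) h {(0 : Esp n)}ᶜ) {x : Esp n} (hx : x ≠ 0) :
    DifferentiableAt ℝ (fderiv ℝ h) x :=
  (fd_cd_at hsm hx).differentiableAt (by simp)

lemma hess_eq (hsm : ContDiffOn ℝ (⊤ : ℕ∞) h {(0 : Esp n)}ᶜ) {x : Esp n} (hx : x ≠ 0)
    (v w : Esp n) : hessForm n h x v w = fderiv ℝ (fderiv ℝ h) x v w := by
  unfold hessForm
  rw [fderiv_clm_apply (fd_diff_at hsm hx) (differentiableAt_const w)]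
  simp

lemma euler (hsm : ContDiffOn ℝ (⊤ : ℕ∞) h {(0 : Esp n)}ᶜ) (hhom : PosHom n h)
    {x : Esp n} (hx : x ≠ 0) : fderiv ℝ h x x = h x := by
  have h1 : HasDerivAt (fun r : ℝ => h (r • x)) (fderiv ℝ h x x) 1 := by
    have hd : HasFDerivAt h (fderiv ℝ h x) ((1 : ℝ) • x) := by
      rw [one_smul]; exact (diff_at hsm hx).hasFDerivAt
    have := hd.comp_hasDerivAt (1 : ℝ) ((hasDerivAt_id (1 : ℝ)).smul_const x)
    rw [one_smul] at this
    exact this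
  have h2 : HasDerivAt (fun r : ℝ => h (r • x)) (h x) 1 := by
    have h3 : HasDerivAt (fun r : ℝ => r * h x) (h x) 1 := by
      simpa using (hasDerivAt_id (1 : ℝ)).mul_const (h x)
    refine h3.congr_of_eventuallyEq ?_
    filter_upwards [lt_mem_nhds (zero_lt_one)] with r hr
    exact hhom r hr x
  exact h1.unique h2

lemma fderiv_hom {F : Type*} [NormedAddCommGroup F] [NormedSpace ℝ F] {f : Esp n → F}
    (hf : ∀ r : ℝ, 0 < r → ∀ x, f (r • x) = r • f x) {r : ℝ} (hr : 0 < r) (x : Esp n) :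
    fderiv ℝ f (r • x) = fderiv ℝ f x := by
  have h1 := fderiv_comp_smul (𝕜 := ℝ) (f := f) (x := x) r
  have h2 : (fun y => f (r • y)) = fun y => r • f y := by
    funext y; exact hf r hr y
  let _ := invertibleOfNonzero hr.ne'
  have h4 : fderiv ℝ (fun y => r • f y) x = r • fderiv ℝ f x :=
    fderiv_const_smul_of_invertible (f := f) (x := x) r
  rw [h2, h4] at h1
  exact (smul_right_injective _ hr.ne' h1).symm

lemma hess_euler (hsm : ContDiffOn ℝ (⊤ : ℕ∞) h {(0 : Esp n)}ᶜ) (hhom : PosHom n h)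
    {x : Esp n} (hx : x ≠ 0) (v : Esp n) : hessForm n h x v x = 0 := by
  rw [hess_eq hsm hx]
  have h1 : fderiv ℝ (fun y => fderiv ℝ h y y) x = fderiv ℝ h x := by
    apply Filter.EventuallyEq.fderiv_eq
    filter_upwards [isOpen_compl_singleton.mem_nhds hx] with y hy
    exact euler hsm hhom hy
  have h2 := fderiv_clm_apply (fd_diff_at hsm hx) (differentiableAt_id (x := x))
  have h3 := congrArg (fun L => L v) (h2.symm.trans h1)
  simpa using h3

/-- The parametrization of the body by `x ↦ ‖x‖ ∇h(x)`. -/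
def Psi (h : Esp n → ℝ) (x : Esp n) : Esp n := ‖x‖ • gradient h x

lemma inner_grad (x v : Esp n) : ⟪gradient h x, v⟫ = fderiv ℝ h x v := by
  unfold gradient
  simp

lemma Psi_hom (hhom : PosHom n h) (r : ℝ) (hr : 0 < r) (x : Esp n) :
    Psi h (r • x) = r • Psi h x := by
  unfold Psi gradient
  rw [fderiv_hom (fun r hr x => by simpa using hhom r hr x) hr, norm_smul, Real.norm_of_nonneg hr.le,
    smul_smul]

lemma Psi_hasFDerivAt (hsm : ContDiffOn ℝ (⊤ : ℕ∞) h {(0 : Esp n)}ᶜ) {x : Esp n} (hx : x ≠ 0) :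
    DifferentiableAt ℝ (Psi h) x := by
  unfold Psi gradient
  refine DifferentiableAt.smul (differentiableAt_id.norm ℝ hx) ?_
  exact ((InnerProductSpace.toDual ℝ (Esp n)).symm.toContinuousLinearEquiv
    |>.differentiableAt).comp x (fd_diff_at hsm hx)

lemma Psi_fderiv (hsm : ContDiffOn ℝ (⊤ : ℕ∞) h {(0 : Esp n)}ᶜ) {x : Esp n} (hx : ‖x‖ = 1)
    (v w : Esp n) :
    ⟪fderiv ℝ (Psi h) x v, w⟫ = ⟪x, v⟫ * fderiv ℝ h x w + hessForm n h x v w := by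
  have hx0 : x ≠ 0 := by rintro rfl; simp at hx
  have h1 : fderiv ℝ (fun y => ⟪Psi h y, w⟫) x v = ⟪fderiv ℝ (Psi h) x v, w⟫ := by
    rw [fderiv_inner_apply ℝ (Psi_hasFDerivAt hsm hx0) (differentiableAt_const w)]
    simp
  have h2 : (fun y => ⟪Psi h y, w⟫) = fun y => ‖y‖ * fderiv ℝ h y w := by
    funext y
    rw [Psi, real_inner_smul_left, inner_grad]
  have hn : HasFDerivAt (fun y : Esp n => ‖y‖) (innerSL ℝ x) x := by
    have := (hasStrictFDerivAt_norm_sq x).hasFDerivAt.sqrt (by simp [hx])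
    simp [hx, Real.sqrt_sq] at this
    refine this.congr_fderiv (ContinuousLinearMap.ext fun v => ?_)
    change (2⁻¹ : ℝ) * (2 • ⟪x, v⟫) = ⟪x, v⟫
    rw [two_nsmul]; ring
  have hd : DifferentiableAt ℝ (fun y => fderiv ℝ h y w) x :=
    (fd_diff_at hsm hx0).clm_apply (differentiableAt_const w)
  have h6 := (hn.mul hd.hasFDerivAt).fderiv
  rw [← h1, h2]
  change fderiv ℝ ((fun y => ‖y‖) * fun y => (fderiv ℝ h y) w) x v = _
  rw [h6]
  simp [hx, hessForm]
  ring

lemma clm_expand (L : Esp n →L[ℝ] ℝ) (x : Esp n) :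
    ∑ i, x i * L (EuclideanSpace.single i 1) = L x := by
  conv_rhs => rw [← (EuclideanSpace.basisFun (Fin (n+1)) ℝ).sum_repr x]
  simp

lemma Psi_det (hsm : ContDiffOn ℝ (⊤ : ℕ∞) h {(0 : Esp n)}ᶜ) (hhom : PosHom n h)
    {x : Esp n} (hx : ‖x‖ = 1) (hp : 0 < h x) :
    (fderiv ℝ (Psi h) x).det = h x * sigmaElem n n h x := by
  have hx0 : x ≠ 0 := by rintro rfl; simp at hx
  have hb : (fun i => x i) ⬝ᵥ (fun j => fderiv ℝ h x (EuclideanSpace.single j 1)) = h x := by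
    rw [← euler hsm hhom hx0]
    exact clm_expand _ x
  have hA : Matrix.vecMul (fun i => x i) (hessMatrix n h x).transpose = 0 := by
    rw [Matrix.vecMul_transpose]
    funext i
    have := hess_euler hsm hhom hx0 (EuclideanSpace.single i 1)
    rw [hess_eq hsm hx0] at this
    rw [← clm_expand] at this
    simp only [Matrix.mulVec, dotProduct, hessMatrix, Matrix.of_apply, Pi.zero_apply]
    rw [← this]
    refine Finset.sum_congr rfl fun j _ => ?_
    rw [hess_eq hsm hx0, mul_comm]
  have hM : LinearMap.toMatrix (EuclideanSpace.basisFun (Fin (n+1)) ℝ).toBasis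
      (EuclideanSpace.basisFun (Fin (n+1)) ℝ).toBasis (fderiv ℝ (Psi h) x : Esp n →ₗ[ℝ] Esp n)
      = (hessMatrix n h x).transpose + Matrix.vecMulVec
        (fun j => fderiv ℝ h x (EuclideanSpace.single j 1)) (fun i => x i) := by
    ext i j
    have := Psi_fderiv hsm hx (EuclideanSpace.single j 1) (EuclideanSpace.single i 1)
    simp [EuclideanSpace.inner_single_right] at this
    simp [LinearMap.toMatrix_apply, hessMatrix, Matrix.vecMulVec, this]
    ring
  rw [ContinuousLinearMap.det, ← LinearMap.det_toMatrix (EuclideanSpace.basisFun (Fin (n+1)) ℝ).toBasis,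
    hM, det_rankone _ _ _ hA (by rw [hb]; exact hp.ne'), hb, Matrix.charpoly_transpose]
  simp [sigmaElem]
end Calc

section Conv
variable {n : ℕ} {h : Esp n → ℝ}

lemma hess_symm (hsm : ContDiffOn ℝ (⊤ : ℕ∞) h {(0 : Esp n)}ᶜ) {x : Esp n} (hx : x ≠ 0)
    (v w : Esp n) : hessForm n h x v w = hessForm n h x w v := by
  rw [hess_eq hsm hx, hess_eq hsm hx]
  exact ((cd_at hsm hx).isSymmSndFDerivAt (by simp; exact WithTop.coe_le_coe.2 le_top)) v w

lemma hess_scale (hsm : ContDiffOn ℝ (⊤ : ℕ∞) h {(0 : Esp n)}ᶜ) (hhom : PosHom n h)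
    {x : Esp n} (hx : x ≠ 0) {r : ℝ} (hr : 0 < r) (v w : Esp n) :
    hessForm n h x v w = r * hessForm n h (r • x) v w := by
  rw [hess_eq hsm hx, hess_eq hsm (smul_ne_zero hr.ne' hx)]
  have h1 := fderiv_comp_smul (𝕜 := ℝ) (f := fderiv ℝ h) (x := x) r
  have h2 : (fun y => fderiv ℝ h (r • y)) = fderiv ℝ h := by
    funext y; exact fderiv_hom (fun r hr x => by simpa using hhom r hr x) hr y
  rw [h2] at h1
  conv_lhs => rw [h1]
  simp

lemma hess_pos (hsm : ContDiffOn ℝ (⊤ : ℕ∞) h {(0 : Esp n)}ᶜ) (hhom : PosHom n h)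
    (hconv : ∀ x ∈ sphere (0 : Esp n) 1, ∀ v : Esp n,
      ⟪v, x⟫ = 0 → v ≠ 0 → 0 < hessForm n h x v v)
    {z : Esp n} (hz : z ≠ 0) (v : Esp n) (hv : ∀ c : ℝ, v ≠ c • z) : 0 < hessForm n h z v v := by
  have hzn : 0 < ‖z‖ := norm_pos_iff.2 hz
  have hr : 0 < ‖z‖⁻¹ := inv_pos.2 hzn
  rw [hess_scale hsm hhom hz hr]
  refine mul_pos hr ?_
  set x := ‖z‖⁻¹ • z with hxdef
  have hx1 : ‖x‖ = 1 := by simp [hxdef, norm_smul, hzn.ne']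
  have hx0 : x ≠ 0 := by rintro h0; simp [h0] at hx1
  have hpos := hconv x (by simp [hx1]) (v - ⟪v, x⟫ • x)
    (by rw [inner_sub_left, real_inner_smul_left, real_inner_self_eq_norm_sq, hx1]; ring)
    (by
      intro h0
      apply hv (⟪v, x⟫ * ‖z‖⁻¹)
      rw [mul_smul]; exact sub_eq_zero.1 h0)
  have e1 := hess_euler hsm hhom hx0 v
  have e2 := hess_euler hsm hhom hx0 x
  have e3 := hess_symm hsm hx0 v x
  rw [hess_eq hsm hx0] at e1 e2 hpos ⊢
  rw [hess_eq hsm hx0, hess_eq hsm hx0] at e3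
  simp only [map_sub, map_smul, sub_apply, smul_apply,
    smul_eq_mul, e1, e2, ← e3] at hpos
  simpa using hpos

lemma supp_lt (hsm : ContDiffOn ℝ (⊤ : ℕ∞) h {(0 : Esp n)}ᶜ) (hhom : PosHom n h)
    (hconv : ∀ x ∈ sphere (0 : Esp n) 1, ∀ v : Esp n,
      ⟪v, x⟫ = 0 → v ≠ 0 → 0 < hessForm n h x v v)
    (hpos : ∀ x ∈ sphere (0 : Esp n) 1, 0 < h x)
    {x w : Esp n} (hx : ‖x‖ = 1) (hw : ‖w‖ = 1) (hne : x ≠ w) : fderiv ℝ h x w < h w := by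
  have hx0 : x ≠ 0 := by rintro rfl; simp at hx
  by_cases hc : ∃ c : ℝ, w = c • x
  · obtain ⟨c, rfl⟩ := hc
    have hc1 : |c| = 1 := by simpa [norm_smul, hx] using hw
    have : c = -1 := by
      rcases eq_or_eq_neg_of_abs_eq hc1 with h1 | h1
      · subst h1; simp at hne
      · exact h1
    subst this
    have p1 := hpos _ (show (-1 : ℝ) • x ∈ sphere (0 : Esp n) 1 by simpa using hx)
    have p2 := hpos _ (show x ∈ sphere (0 : Esp n) 1 by simpa using hx)
    rw [map_smul, euler hsm hhom hx0, smul_eq_mul]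
    linarith
  · push Not at hc
    have hγ : ∀ τ : ℝ, x + τ • (w - x) ≠ 0 := by
      intro τ h0
      by_cases hτ : τ = 0
      · simp [hτ] at h0; exact hx0 h0
      · apply hc (τ⁻¹ * (τ - 1))
        have : τ • w = (τ - 1) • x := by
          rw [sub_smul, one_smul, eq_sub_iff_add_eq, ← sub_eq_zero, ← h0, smul_sub]
          have h0' := h0
          rw [smul_sub] at h0'
          rw [h0']
          have : τ • w = τ • x - x := by rw [← sub_eq_zero, ← h0']; abel
          rw [this]
          simp
        rw [mul_smul, ← this, smul_smul, inv_mul_cancel₀ hτ, one_smul]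
    have hd : ∀ τ c : ℝ, w - x ≠ c • (x + τ • (w - x)) := by
      intro τ c h0
      have h1 : (1 - c * τ) • w = (1 - c * τ + c) • x := by
        rw [← sub_eq_zero] at h0 ⊢
        rw [← h0]; module
      by_cases h2 : 1 - c * τ = 0
      · rw [h2, zero_smul, zero_add] at h1
        have hc0 : c = 0 := by
          rcases smul_eq_zero.1 h1.symm with h3 | h3
          · exact h3
          · exact absurd h3 hx0
        rw [hc0] at h2; norm_num at h2
      · apply hc ((1 - c * τ)⁻¹ * (1 - c * τ + c))
        rw [mul_smul, ← h1, smul_smul, inv_mul_cancel₀ h2, one_smul]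
    have hγd : ∀ τ : ℝ, HasDerivAt (fun τ : ℝ => x + τ • (w - x)) (w - x) τ := by
      intro τ
      simpa using ((hasDerivAt_id τ).smul_const (w - x)).const_add x
    have g1 : ∀ τ : ℝ, HasDerivAt (fun τ : ℝ => h (x + τ • (w - x)))
        (fderiv ℝ h (x + τ • (w - x)) (w - x)) τ := fun τ =>
      (diff_at hsm (hγ τ)).hasFDerivAt.comp_hasDerivAt τ (hγd τ)
    have g2 : ∀ τ : ℝ, HasDerivAt (fun τ : ℝ => fderiv ℝ h (x + τ • (w - x)) (w - x))
        (hessForm n h (x + τ • (w - x)) (w - x) (w - x)) τ := fun τ =>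
      HasFDerivAt.comp_hasDerivAt (f := fun τ : ℝ => x + τ • (w - x)) τ
        (((fd_diff_at hsm (hγ τ)).clm_apply (differentiableAt_const (w - x))).hasFDerivAt) (hγd τ)
    obtain ⟨c, hc1, hc2⟩ := exists_hasDerivAt_eq_slope _ _ (zero_lt_one' ℝ)
      (fun τ _ => (g1 τ).continuousAt.continuousWithinAt) (fun τ _ => g1 τ)
    obtain ⟨d, hd1, hd2⟩ := exists_hasDerivAt_eq_slope _ _ hc1.1
      (fun τ _ => (g2 τ).continuousAt.continuousWithinAt) (fun τ _ => g2 τ)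
    have hp := hess_pos hsm hhom hconv (hγ d) (w - x) (hd d)
    rw [hd2, hc2] at hp
    simp at hp
    have := hc1.1
    have h3 := (div_pos_iff_of_pos_right this).1 hp
    rw [euler hsm hhom hx0] at h3
    linarith

lemma supp_le (hsm : ContDiffOn ℝ (⊤ : ℕ∞) h {(0 : Esp n)}ᶜ) (hhom : PosHom n h)
    (hconv : ∀ x ∈ sphere (0 : Esp n) 1, ∀ v : Esp n,
      ⟪v, x⟫ = 0 → v ≠ 0 → 0 < hessForm n h x v v)
    (hpos : ∀ x ∈ sphere (0 : Esp n) 1, 0 < h x)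
    {x w : Esp n} (hx : ‖x‖ = 1) (hw : ‖w‖ = 1) : fderiv ℝ h x w ≤ h w := by
  by_cases hne : x = w
  · subst hne
    exact (euler hsm hhom (by rintro rfl; simp at hx)).le
  · exact (supp_lt hsm hhom hconv hpos hx hw hne).le

lemma Psi_unit (hhom : PosHom n h) {x : Esp n} (hx : x ≠ 0) :
    Psi h x = ‖x‖ • gradient h (‖x‖⁻¹ • x) := by
  have : 0 < ‖x‖ := norm_pos_iff.2 hx
  unfold Psi gradient
  rw [fderiv_hom (fun r hr x => by simpa using hhom r hr x) (inv_pos.2 this)]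

lemma norm_unit {x : Esp n} (hx : x ≠ 0) : ‖‖x‖⁻¹ • x‖ = 1 := by
  have : 0 < ‖x‖ := norm_pos_iff.2 hx
  simp [norm_smul, this.ne']

lemma Psi_inj (hsm : ContDiffOn ℝ (⊤ : ℕ∞) h {(0 : Esp n)}ᶜ) (hhom : PosHom n h)
    (hconv : ∀ x ∈ sphere (0 : Esp n) 1, ∀ v : Esp n,
      ⟪v, x⟫ = 0 → v ≠ 0 → 0 < hessForm n h x v v)
    (hpos : ∀ x ∈ sphere (0 : Esp n) 1, 0 < h x) : Set.InjOn (Psi h) {(0 : Esp n)}ᶜ := by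
  have aux : ∀ x y : Esp n, x ≠ 0 → y ≠ 0 → Psi h x = Psi h y → ‖x‖ ≤ ‖y‖ → x = y := by
    intro x y hx hy hxy hle
    have hx1 := norm_unit hx
    have hy1 := norm_unit hy
    have hxp : 0 < ‖x‖ := norm_pos_iff.2 hx
    have hyp : 0 < ‖y‖ := norm_pos_iff.2 hy
    rw [Psi_unit hhom hx, Psi_unit hhom hy] at hxy
    set p := ‖x‖⁻¹ • x
    set q := ‖y‖⁻¹ • y
    have h1 := congrArg (fun z => ⟪z, q⟫) hxy
    simp only [real_inner_smul_left, inner_grad] at h1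
    rw [euler hsm hhom (x := q) (by intro h0; simp [h0] at hy1)] at h1
    have hq := hpos q (by simpa using hy1)
    have hpq : p = q := by
      by_contra hne
      have := supp_lt hsm hhom hconv hpos hx1 hy1 hne
      nlinarith
    have hnn : ‖x‖ = ‖y‖ := by
      rw [hpq, euler hsm hhom (x := q) (by intro h0; simp [h0] at hy1)] at h1
      exact mul_right_cancel₀ hq.ne' h1
    calc x = ‖x‖ • p := by simp [p, smul_smul, hxp.ne']
      _ = ‖y‖ • q := by rw [hnn, hpq]
      _ = y := by simp [q, smul_smul, hyp.ne']
  intro x hx y hy hxy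
  rcases le_total ‖x‖ ‖y‖ with hle | hle
  · exact aux x y hx hy hxy hle
  · exact (aux y x hy hx hxy.symm hle).symm

lemma Psi_surj (hsm : ContDiffOn ℝ (⊤ : ℕ∞) h {(0 : Esp n)}ᶜ) (hhom : PosHom n h)
    (hpos : ∀ x ∈ sphere (0 : Esp n) 1, 0 < h x) {y : Esp n} (hy : y ≠ 0) :
    ∃ w : Esp n, ‖w‖ = 1 ∧ ∃ s : ℝ, 0 < s ∧ y = s • gradient h w := by
  have hne : ∀ w ∈ sphere (0 : Esp n) 1, w ≠ 0 := by
    intro w hw h0; simp [h0] at hw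
  have hcont : ContinuousOn (fun w => ⟪y, w⟫ / h w) (sphere (0 : Esp n) 1) := by
    refine ContinuousOn.div (by fun_prop) ?_ (fun w hw => (hpos w hw).ne')
    exact hsm.continuousOn.mono (fun w hw => hne w hw)
  have hyu : ‖y‖⁻¹ • y ∈ sphere (0 : Esp n) 1 := by simpa using norm_unit hy
  obtain ⟨w, hw, hmax⟩ := (isCompact_sphere (0 : Esp n) 1).exists_isMaxOn ⟨_, hyu⟩ hcont
  have hw1 : ‖w‖ = 1 := by simpa using hw
  set s := ⟪y, w⟫ / h w with hs
  have hspos : 0 < s := by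
    refine lt_of_lt_of_le ?_ (hmax hyu)
    refine div_pos ?_ (hpos _ hyu)
    rw [real_inner_smul_right, real_inner_self_eq_norm_sq]
    have : 0 < ‖y‖ := norm_pos_iff.2 hy
    positivity
  have hle : ∀ z : Esp n, z ≠ 0 → ⟪y, z⟫ - s * h z ≤ 0 := by
    intro z hz
    have hzp : 0 < ‖z‖ := norm_pos_iff.2 hz
    have hzu : ‖z‖⁻¹ • z ∈ sphere (0 : Esp n) 1 := by simpa using norm_unit hz
    have h1 : ⟪y, ‖z‖⁻¹ • z⟫ / h (‖z‖⁻¹ • z) ≤ s := hmax hzu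
    rw [div_le_iff₀ (hpos _ hzu), hhom _ (inv_pos.2 hzp), real_inner_smul_right] at h1
    have : ‖z‖⁻¹ * (⟪y, z⟫ - s * h z) ≤ 0 := by linarith
    by_contra hcon
    push Not at hcon
    have := mul_pos (inv_pos.2 hzp) hcon
    linarith
  have hmx : IsLocalMax (fun z => ⟪y, z⟫ - s * h z) w := by
    filter_upwards [isOpen_compl_singleton.mem_nhds (hne w hw)] with z hz
    refine (hle z hz).trans ?_
    rw [hs, div_mul_cancel₀ _ (hpos w hw).ne']
    simp
  have hfd : HasFDerivAt (fun z => ⟪y, z⟫ - s * h z) (innerSL ℝ y - s • fderiv ℝ h w) w :=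
    (innerSL ℝ y).hasFDerivAt.sub ((diff_at hsm (hne w hw)).hasFDerivAt.const_mul s)
  have h0 := hmx.hasFDerivAt_eq_zero hfd
  refine ⟨w, hw1, s, hspos, ?_⟩
  refine ext_inner_right ℝ fun v => ?_
  rw [real_inner_smul_left, inner_grad]
  have := congrArg (fun L => L v) h0
  simp at this
  linarith
end Conv

section Steiner
variable {n : ℕ}

/-- The convex body (Wulff shape) cut out by `k`. -/
def body (k : Esp n → ℝ) : Set (Esp n) := {y | ∀ w : Esp n, ‖w‖ = 1 → ⟪y, w⟫ ≤ k w}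

lemma body_closed (k : Esp n → ℝ) : IsClosed (body k) := by
  have : body k = ⋂ w : Esp n, ⋂ _ : ‖w‖ = 1, {y | ⟪y, w⟫ ≤ k w} := by
    ext y; simp [body]
  rw [this]
  exact isClosed_iInter fun w => isClosed_iInter fun _ =>
    isClosed_le (by fun_prop) continuous_const

lemma body_convex (k : Esp n → ℝ) : Convex ℝ (body k) := by
  intro x hx y hy a b ha hb hab w hw
  rw [inner_add_left, real_inner_smul_left, real_inner_smul_left]
  have h1 := mul_le_mul_of_nonneg_left (hx w hw) ha
  have h2 := mul_le_mul_of_nonneg_left (hy w hw) hb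
  have : a * k w + b * k w = k w := by rw [← add_mul, hab, one_mul]
  linarith

lemma body_bdd {k : Esp n → ℝ} {C : ℝ} (hC : ∀ w : Esp n, ‖w‖ = 1 → k w ≤ C) (hC0 : 0 ≤ C) :
    body k ⊆ closedBall 0 C := by
  intro y hy
  rw [mem_closedBall_zero_iff]
  by_cases h0 : y = 0
  · simpa [h0] using hC0
  · have h1 := (hy _ (norm_unit h0)).trans (hC _ (norm_unit h0))
    rw [real_inner_smul_right, real_inner_self_eq_norm_sq] at h1
    have : 0 < ‖y‖ := norm_pos_iff.2 h0
    rwa [pow_two, inv_mul_cancel_left₀ this.ne'] at h1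

lemma oned {S T : Set ℝ} (hS : IsCompact S) (hc : Convex ℝ S) (t : ℝ)
    (hT : ∀ s ∈ S, ∀ s' ∈ S, (1 - t) * s - t * s' ∈ T) : volume S ≤ volume T := by
  rcases S.eq_empty_or_nonempty with rfl | hne
  · simp
  have hI := eq_Icc_of_connected_compact ⟨hne, hc.isPreconnected⟩ hS
  set a := sInf S
  set c := sSup S
  have hsub : S ⊆ (fun s => s + (-(t * (a + c)))) ⁻¹' T := by
    intro s hs
    have hs' : a + c - s ∈ S := by
      rw [hI] at hs ⊢
      constructor <;> linarith [hs.1, hs.2]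
    have := hT s hs _ hs'
    have e : (1 - t) * s - t * (a + c - s) = s + -(t * (a + c)) := by ring
    rwa [e] at this
  calc volume S ≤ volume ((fun s => s + (-(t * (a + c)))) ⁻¹' T) := measure_mono hsub
    _ = volume T := measure_preimage_add_right _ _ _

lemma exists_fibration (e : Esp n) (he : ‖e‖ = 1) :
    ∃ G : ℝ × (Fin n → ℝ) → Esp n, MeasurePreserving G volume volume ∧ Continuous G ∧
      (∀ s q, G (s, q) = s • e + G (0, q)) ∧ ∀ q, ⟪G (0, q), e⟫ = 0 := by
  have hon : Orthonormal ℝ (({0} : Set (Fin (n+1))).domRestrict (fun _ => e)) := by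
    constructor
    · intro i; exact he
    · intro i j hij; exact absurd (Subsingleton.elim i j) hij
  obtain ⟨b, hb⟩ := hon.exists_orthonormalBasis_extension_of_card_eq (by simp)
  have hb0 : b 0 = e := hb 0 (by simp)
  have hG : ∀ z : ℝ × (Fin n → ℝ), b.repr.symm (WithLp.toLp 2
      ((MeasurableEquiv.piFinSuccAbove (fun _ : Fin (n+1) => ℝ) 0).symm z)) =
      z.1 • e + ∑ i : Fin n, z.2 i • b i.succ := by
    intro z
    rw [← b.sum_repr (b.repr.symm _), Fin.sum_univ_succ]
    simp [hb0, MeasurableEquiv.piFinSuccAbove]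
  have hmp := b.measurePreserving_repr_symm.comp ((PiLp.volume_preserving_toLp (Fin (n+1))).comp
      (volume_preserving_piFinSuccAbove (fun _ : Fin (n+1) => ℝ) 0).symm)
  refine ⟨fun z => z.1 • e + ∑ i : Fin n, z.2 i • b i.succ, ?_, by fun_prop, ?_, ?_⟩
  · have hfun : (fun z : ℝ × (Fin n → ℝ) => z.1 • e + ∑ i : Fin n, z.2 i • b i.succ) =
        (⇑b.repr.symm ∘ WithLp.toLp 2 ∘
          ⇑(MeasurableEquiv.piFinSuccAbove (fun _ : Fin (n+1) => ℝ) 0).symm) :=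
      funext fun z => (hG z).symm
    rw [hfun]
    exact hmp
  · intro s q; simp
  · intro q
    simp only [zero_smul, zero_add, sum_inner, real_inner_smul_left]
    refine Finset.sum_eq_zero fun i _ => ?_
    rw [← hb0, b.inner_eq_zero (Fin.succ_ne_zero i), mul_zero]

lemma steiner {h : Esp n → ℝ} {C : ℝ} (hC : ∀ w : Esp n, ‖w‖ = 1 → h w ≤ C) (hC0 : 0 ≤ C)
    (e : Esp n) (he : ‖e‖ = 1) (R : Esp n ≃ₗᵢ[ℝ] Esp n) (hRR : ∀ x, R (R x) = x)
    (hRe : R e = -e) (hRp : ∀ p, ⟪p, e⟫ = 0 → R p = p) {t : ℝ} (ht0 : 0 ≤ t) (ht1 : t ≤ 1) :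
    volume (body h) ≤ volume (body fun w => (1 - t) * h w + t * h (R w)) := by
  obtain ⟨G, hG, hGc, hG1, hG2⟩ := exists_fibration e he
  rw [← hG.measure_preimage (body_closed _).measurableSet.nullMeasurableSet,
    ← hG.measure_preimage (body_closed _).measurableSet.nullMeasurableSet]
  rw [Measure.volume_eq_prod, Measure.prod_apply_symm (hGc.measurable (body_closed _).measurableSet),
    Measure.prod_apply_symm (hGc.measurable (body_closed _).measurableSet)]
  refine lintegral_mono fun q => ?_
  refine oned (t := t) ?_ ?_ ?_
  · have hcl : IsClosed ((fun s => (s, q)) ⁻¹' (G ⁻¹' body h)) :=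
      (body_closed h).preimage (hGc.comp (by fun_prop))
    refine (isCompact_closedBall (0 : ℝ) C).of_isClosed_subset hcl ?_
    intro s hs
    have h1 := body_bdd hC hC0 hs
    rw [mem_closedBall_zero_iff] at h1 ⊢
    refine le_trans ?_ h1
    have h2 : ⟪G (s, q), e⟫ = s := by
      rw [hG1, inner_add_left, hG2, real_inner_smul_left, real_inner_self_eq_norm_sq, he]; simp
    have h3 := abs_real_inner_le_norm (G (s, q)) e
    rwa [h2, he, mul_one] at h3
  · intro s hs s' hs' a b ha hb hab
    have := body_convex h hs hs' ha hb hab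
    simp only [Set.mem_preimage] at this ⊢
    convert this using 1
    rw [hG1, hG1 s, hG1 s']
    have : G (0, q) = (a + b) • G (0, q) := by rw [hab, one_smul]
    conv_lhs => rw [this]
    simp only [smul_eq_mul]
    module
  · intro s hs s' hs' w hw
    have h1 := hs w hw
    have h2 := hs' (R w) (by simpa using hw)
    have h3 : ⟪R (G (s', q)), w⟫ = ⟪G (s', q), R w⟫ := by
      rw [← R.inner_map_map, hRR]
    rw [← h3] at h2
    have h4 : G ((1 - t) * s - t * s', q) = (1 - t) • G (s, q) + t • R (G (s', q)) := by
      rw [hG1, hG1 s, hG1 s', map_add, map_smul, hRe, hRp _ (hG2 q)]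
      module
    change ⟪G ((1 - t) * s - t * s', q), w⟫ ≤ _
    rw [h4, inner_add_left, real_inner_smul_left, real_inner_smul_left]
    have h5 := mul_le_mul_of_nonneg_left h1 (sub_nonneg.2 ht1)
    have h6 := mul_le_mul_of_nonneg_left h2 ht0
    exact add_le_add h5 h6
end Steiner

section Polar
variable {n : ℕ}

lemma volumeIoiPow_Iic (m : ℕ) (x : Set.Ioi (0 : ℝ)) :
    Measure.volumeIoiPow m (Set.Iic x) = ENNReal.ofReal (x.1 ^ (m + 1) / (m + 1)) := by
  rw [← Measure.volumeIoiPow_apply_Iio, ← Set.Iio_union_right]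
  refine le_antisymm ((measure_union_le _ _).trans ?_) (measure_mono Set.subset_union_left)
  have : Measure.volumeIoiPow m {x} = 0 := by
    unfold Measure.volumeIoiPow
    refine withDensity_absolutelyContinuous _ _ ?_
    rw [comap_subtype_coe_apply measurableSet_Ioi]
    simp
  rw [this, add_zero]

lemma polar_meas {ρ : Esp n → ℝ} (hρ : Measurable fun ω : sphere (0 : Esp n) 1 => ρ ω) :
    MeasurableSet {x : Esp n | x ≠ 0 ∧ ‖x‖ ≤ ρ (‖x‖⁻¹ • x)} := by
  have hset : MeasurableSet {z : sphere (0 : Esp n) 1 × Set.Ioi (0 : ℝ) | (z.2 : ℝ) ≤ ρ z.1} :=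
    measurableSet_le (measurable_subtype_coe.comp measurable_snd) (hρ.comp measurable_fst)
  have hhat : ∀ x : ({0}ᶜ : Set (Esp n)),
      ((homeomorphUnitSphereProd (Esp n) x).1 : Esp n) = ‖(x : Esp n)‖⁻¹ • (x : Esp n) := by
    intro x; simp
  have h1 : {x : Esp n | x ≠ 0 ∧ ‖x‖ ≤ ρ (‖x‖⁻¹ • x)} = Subtype.val ''
      ((homeomorphUnitSphereProd (Esp n)) ⁻¹' {z | (z.2 : ℝ) ≤ ρ z.1}) := by
    ext x
    simp only [Set.mem_ofPred_eq, Set.mem_image, Set.mem_preimage, Subtype.exists, hhat]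
    simp [and_comm]
  rw [h1]
  exact (MeasurableEmbedding.subtype_coe (measurableSet_singleton _).compl).measurableSet_image.2
    ((homeomorphUnitSphereProd (Esp n)).measurable hset)

lemma polar {F : Esp n → ENNReal} {ρ : Esp n → ℝ}
    (hF : Measurable fun ω : sphere (0 : Esp n) 1 => F ω)
    (hρ : Measurable fun ω : sphere (0 : Esp n) 1 => ρ ω)
    (hρ0 : ∀ ω : sphere (0 : Esp n) 1, 0 < ρ ω) :
    ∫⁻ x in {x : Esp n | x ≠ 0 ∧ ‖x‖ ≤ ρ (‖x‖⁻¹ • x)}, F (‖x‖⁻¹ • x) =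
      ∫⁻ ω, F ω * ENNReal.ofReal (ρ ω ^ (n + 1) / (n + 1))
        ∂(volume : Measure (Esp n)).toSphere := by
  classical
  set g' : sphere (0 : Esp n) 1 × Set.Ioi (0 : ℝ) → ENNReal :=
    Set.indicator {z | (z.2 : ℝ) ≤ ρ z.1} (fun z => F z.1) with hg'
  have hset : MeasurableSet {z : sphere (0 : Esp n) 1 × Set.Ioi (0 : ℝ) | (z.2 : ℝ) ≤ ρ z.1} :=
    measurableSet_le (measurable_subtype_coe.comp measurable_snd) (hρ.comp measurable_fst)
  have hg'm : Measurable g' := (hF.comp measurable_fst).indicator hset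
  have hhat : ∀ x : ({0}ᶜ : Set (Esp n)),
      ((homeomorphUnitSphereProd (Esp n) x).1 : Esp n) = ‖(x : Esp n)‖⁻¹ • (x : Esp n) := by
    intro x; simp
  have hmeas := polar_meas hρ
  have hstep1 : ∫⁻ x in {x : Esp n | x ≠ 0 ∧ ‖x‖ ≤ ρ (‖x‖⁻¹ • x)}, F (‖x‖⁻¹ • x) =
      ∫⁻ z, g' z ∂((volume : Measure (Esp n)).toSphere.prod (Measure.volumeIoiPow n)) := by
    have hmp := (volume : Measure (Esp n)).measurePreserving_homeomorphUnitSphereProd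
    have hfr : Module.finrank ℝ (Esp n) - 1 = n := by simp
    rw [hfr] at hmp
    rw [← hmp.lintegral_comp hg'm, ← lintegral_indicator hmeas]
    have h2 : ∀ x : ({0}ᶜ : Set (Esp n)), g' (homeomorphUnitSphereProd (Esp n) x) =
        Set.indicator {x : Esp n | x ≠ 0 ∧ ‖x‖ ≤ ρ (‖x‖⁻¹ • x)} (fun x => F (‖x‖⁻¹ • x)) x := by
      intro x
      have hx : (x : Esp n) ≠ 0 := x.2
      simp only [hg', Set.indicator_apply, Set.mem_ofPred_eq, hhat]
      simp [hx]
    simp_rw [h2]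
    rw [lintegral_subtype_comap (measurableSet_singleton _).compl, restrict_compl_singleton]
  rw [hstep1, lintegral_prod _ hg'm.aemeasurable]
  refine lintegral_congr fun ω => ?_
  have h3 : ∀ r : Set.Ioi (0 : ℝ), g' (ω, r) =
      Set.indicator (Set.Iic ⟨ρ ω, hρ0 ω⟩) (fun _ => F ω) r := by
    intro r
    simp only [hg', Set.indicator_apply, Set.mem_ofPred_eq, Set.mem_Iic, ← Subtype.coe_le_coe]
  simp_rw [h3]
  rw [lintegral_indicator_const measurableSet_Iic, volumeIoiPow_Iic]

open scoped Pointwise in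
lemma toSphere_map (R : Esp n ≃ₗᵢ[ℝ] Esp n) (S : sphere (0 : Esp n) 1 → sphere (0 : Esp n) 1)
    (hS : ∀ ω, ((S ω : sphere (0 : Esp n) 1) : Esp n) = R ω) :
    MeasurePreserving S (volume : Measure (Esp n)).toSphere (volume : Measure (Esp n)).toSphere := by
  have hSm : Measurable S := by
    have hc : Continuous S := by
      rw [continuous_induced_rng]
      have : (Subtype.val ∘ S) = fun ω : sphere (0 : Esp n) 1 => R ω := funext hS
      rw [this]
      exact R.continuous.comp continuous_subtype_val
    exact hc.measurable
  refine ⟨hSm, Measure.ext fun s hs => ?_⟩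
  rw [Measure.map_apply hSm hs, Measure.toSphere_apply' _ (hSm hs), Measure.toSphere_apply' _ hs]
  congr 1
  have : (Set.Ioo (0 : ℝ) 1 • (Subtype.val '' (S ⁻¹' s)) : Set (Esp n)) =
      R ⁻¹' (Set.Ioo (0 : ℝ) 1 • (Subtype.val '' s)) := by
    ext x
    simp only [Set.mem_smul, Set.mem_image, Set.mem_preimage]
    constructor
    · rintro ⟨r, hr, _, ⟨ω, hω, rfl⟩, rfl⟩
      exact ⟨r, hr, _, ⟨S ω, hω, rfl⟩, by rw [hS, map_smul]⟩
    · rintro ⟨r, hr, _, ⟨ω, hω, rfl⟩, h1⟩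
      have hm : R.symm (ω : Esp n) ∈ sphere (0 : Esp n) 1 := by simp
      refine ⟨r, hr, _, ⟨⟨R.symm ω, hm⟩, ?_, rfl⟩, ?_⟩
      · have : S ⟨R.symm ω, hm⟩ = ω := Subtype.ext (by rw [hS]; simp)
        rw [this]; exact hω
      · apply R.injective
        rw [← h1, map_smul]; simp
  rw [this]
  exact R.measurePreserving.measure_preimage_equiv (f := R.toHomeomorph.toMeasurableEquiv) _
end Polar

section Main
variable {n : ℕ} {h : Esp n → ℝ}

lemma vol_upper (hsm : ContDiffOn ℝ (⊤ : ℕ∞) h {(0 : Esp n)}ᶜ) (hhom : PosHom n h)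
    (hpos : ∀ x ∈ sphere (0 : Esp n) 1, 0 < h x) {G : Esp n → ℝ}
    (hG : ∀ x : Esp n, x ≠ 0 → |(fderiv ℝ (Psi h) x).det| = G (‖x‖⁻¹ • x))
    (hGc : Continuous fun ω : sphere (0 : Esp n) 1 => G ω)
    (hhc : Continuous fun ω : sphere (0 : Esp n) 1 => h ω)
    {k : Esp n → ℝ} (hk : Continuous fun ω : sphere (0 : Esp n) 1 => k ω)
    (hkpos : ∀ x ∈ sphere (0 : Esp n) 1, 0 < k x) :
    volume (body k) ≤ ∫⁻ ω : sphere (0 : Esp n) 1,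
      ENNReal.ofReal (G ω) * ENNReal.ofReal ((k ω / h ω) ^ (n + 1) / (n + 1))
        ∂(volume : Measure (Esp n)).toSphere := by
  have hρ : Continuous fun ω : sphere (0 : Esp n) 1 => k ω / h ω :=
    hk.div hhc fun ω => (hpos ω ω.2).ne'
  have hp := polar (F := fun x => ENNReal.ofReal (G x)) (ρ := fun x => k x / h x)
    (hGc.measurable.ennreal_ofReal) hρ.measurable
    (fun ω => div_pos (hkpos ω ω.2) (hpos ω ω.2))
  rw [← hp]
  set A := {x : Esp n | x ≠ 0 ∧ ‖x‖ ≤ k (‖x‖⁻¹ • x) / h (‖x‖⁻¹ • x)} with hA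
  have hAm : MeasurableSet A := polar_meas (ρ := fun x => k x / h x) hρ.measurable
  have h1 := addHaar_image_le_lintegral_abs_det_fderiv volume hAm
    (fun x hx => (Psi_hasFDerivAt hsm hx.1).hasFDerivAt.hasFDerivWithinAt)
  have h2 : ∫⁻ x in A, ENNReal.ofReal |(fderiv ℝ (Psi h) x).det| =
      ∫⁻ x in A, ENNReal.ofReal (G (‖x‖⁻¹ • x)) :=
    setLIntegral_congr_fun hAm fun x hx => by
      show ENNReal.ofReal _ = _
      rw [hG x hx.1]
  rw [← h2]
  refine le_trans ?_ h1
  have hsub : body k ⊆ Psi h '' A ∪ {0} := by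
    intro y hy
    by_cases hy0 : y = 0
    · right; simpa using hy0
    left
    obtain ⟨w, hw, s, hs, rfl⟩ := Psi_surj hsm hhom hpos hy0
    have hw0 : w ≠ 0 := by rintro rfl; simp at hw
    have hns : ‖s • w‖ = s := by rw [norm_smul, hw, mul_one, Real.norm_of_nonneg hs.le]
    have hhat : ‖s • w‖⁻¹ • (s • w) = w := by
      rw [hns, smul_smul, inv_mul_cancel₀ hs.ne', one_smul]
    refine ⟨s • w, ⟨smul_ne_zero hs.ne' hw0, ?_⟩, ?_⟩
    · rw [hhat, hns, le_div_iff₀ (hpos w (by simpa using hw))]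
      have := hy w hw
      rwa [real_inner_smul_left, inner_grad, euler hsm hhom hw0] at this
    · rw [Psi_hom hhom s hs, Psi, hw, one_smul]
  calc volume (body k) ≤ volume (Psi h '' A ∪ {0}) := measure_mono hsub
    _ ≤ volume (Psi h '' A) + volume {(0 : Esp n)} := measure_union_le _ _
    _ = volume (Psi h '' A) := by simp

lemma vol_lower (hsm : ContDiffOn ℝ (⊤ : ℕ∞) h {(0 : Esp n)}ᶜ) (hhom : PosHom n h)
    (hconv : ∀ x ∈ sphere (0 : Esp n) 1, ∀ v : Esp n,
      ⟪v, x⟫ = 0 → v ≠ 0 → 0 < hessForm n h x v v)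
    (hpos : ∀ x ∈ sphere (0 : Esp n) 1, 0 < h x) {G : Esp n → ℝ}
    (hG : ∀ x : Esp n, x ≠ 0 → |(fderiv ℝ (Psi h) x).det| = G (‖x‖⁻¹ • x))
    (hGc : Continuous fun ω : sphere (0 : Esp n) 1 => G ω) :
    ∫⁻ ω : sphere (0 : Esp n) 1,
      ENNReal.ofReal (G ω) * ENNReal.ofReal ((1 : ℝ) ^ (n + 1) / (n + 1))
        ∂(volume : Measure (Esp n)).toSphere ≤ volume (body h) := by
  have hp := polar (F := fun x => ENNReal.ofReal (G x)) (ρ := fun _ => 1)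
    (hGc.measurable.ennreal_ofReal) measurable_const (fun ω => zero_lt_one)
  rw [← hp]
  set A := {x : Esp n | x ≠ 0 ∧ ‖x‖ ≤ 1} with hA
  have hAm : MeasurableSet A := polar_meas (ρ := fun _ => 1) measurable_const
  have h1 := lintegral_abs_det_fderiv_eq_addHaar_image volume hAm
    (fun x hx => (Psi_hasFDerivAt hsm hx.1).hasFDerivAt.hasFDerivWithinAt)
    ((Psi_inj hsm hhom hconv hpos).mono fun x hx => hx.1)
  have h2 : ∫⁻ x in A, ENNReal.ofReal |(fderiv ℝ (Psi h) x).det| =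
      ∫⁻ x in A, ENNReal.ofReal (G (‖x‖⁻¹ • x)) :=
    setLIntegral_congr_fun hAm fun x hx => by
      show ENNReal.ofReal _ = _
      rw [hG x hx.1]
  rw [← h2, h1]
  refine measure_mono ?_
  rintro _ ⟨x, hx, rfl⟩ w hw
  rw [Psi_unit hhom hx.1, real_inner_smul_left, inner_grad]
  have h3 := supp_le hsm hhom hconv hpos (norm_unit hx.1) hw
  have h4 := hpos w (by simpa using hw)
  have h5 := norm_nonneg x
  have h6 := hx.2
  nlinarith

lemma pow_bound (N : ℕ) (Q : ℝ) (hQ : 0 ≤ Q) : ∃ C : ℝ, 0 ≤ C ∧ ∀ t q : ℝ, 0 ≤ t → t ≤ 1 →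
    |q| ≤ Q → |(1 + t * q) ^ N - 1 - N * t * q| ≤ C * t ^ 2 := by
  induction N with
  | zero => exact ⟨0, le_rfl, by intros; simp⟩
  | succ N ih =>
    obtain ⟨C, hC, ih⟩ := ih
    refine ⟨(1 + Q) * C + N * Q ^ 2, by positivity, fun t q ht ht1 hq => ?_⟩
    have h1 := ih t q ht ht1 hq
    have e : (1 + t * q) ^ (N + 1) - 1 - ((N + 1 : ℕ) : ℝ) * t * q =
        (1 + t * q) * ((1 + t * q) ^ N - 1 - N * t * q) + N * q ^ 2 * t ^ 2 := by
      push_cast; ring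
    have h2 : |1 + t * q| ≤ 1 + Q := by
      refine (abs_add_le _ _).trans ?_
      rw [abs_one, abs_mul, abs_of_nonneg ht]
      have := mul_le_mul ht1 hq (abs_nonneg q) zero_le_one
      linarith
    have h3 : q ^ 2 ≤ Q ^ 2 := by
      rw [← sq_abs q]; gcongr
    rw [e]
    refine (abs_add_le _ _).trans ?_
    rw [abs_mul, abs_of_nonneg (show 0 ≤ N * q ^ 2 * t ^ 2 by positivity), add_mul]
    refine add_le_add ?_ ?_
    · calc _ ≤ (1 + Q) * (C * t ^ 2) := mul_le_mul h2 h1 (abs_nonneg _) (by positivity)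
        _ = _ := by ring
    · gcongr

lemma cont_int {f : sphere (0 : Esp n) 1 → ℝ} (hf : Continuous f) :
    Integrable f (volume : Measure (Esp n)).toSphere :=
  hf.integrable_of_hasCompactSupport (HasCompactSupport.of_compactSpace f)

lemma first_var (hsm : ContDiffOn ℝ (⊤ : ℕ∞) h {(0 : Esp n)}ᶜ) (hhom : PosHom n h)
    (hconv : ∀ x ∈ sphere (0 : Esp n) 1, ∀ v : Esp n,
      ⟪v, x⟫ = 0 → v ≠ 0 → 0 < hessForm n h x v v)
    (hpos : ∀ x ∈ sphere (0 : Esp n) 1, 0 < h x) {G : Esp n → ℝ}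
    (hG : ∀ x : Esp n, x ≠ 0 → |(fderiv ℝ (Psi h) x).det| = G (‖x‖⁻¹ • x))
    (hG0 : ∀ ω : sphere (0 : Esp n) 1, 0 < G ω)
    (hGc : Continuous fun ω : sphere (0 : Esp n) 1 => G ω)
    (e : Esp n) (he : ‖e‖ = 1) (R : Esp n ≃ₗᵢ[ℝ] Esp n) (hRR : ∀ x, R (R x) = x)
    (hRe : R e = -e) (hRp : ∀ p, ⟪p, e⟫ = 0 → R p = p) :
    0 ≤ ∫ ω : sphere (0 : Esp n) 1, G ω * (h (R ω) / h ω - 1)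
      ∂(volume : Measure (Esp n)).toSphere := by
  have hne : ∀ ω : sphere (0 : Esp n) 1, (ω : Esp n) ≠ 0 := fun ω h0 => by
    have := ω.2; simp [h0] at this
  have hRs : ∀ ω : sphere (0 : Esp n) 1, R ω ∈ sphere (0 : Esp n) 1 := fun ω => by simp
  have hhc : Continuous fun ω : sphere (0 : Esp n) 1 => h ω :=
    hsm.continuousOn.comp_continuous continuous_subtype_val hne
  have hhRc : Continuous fun ω : sphere (0 : Esp n) 1 => h (R ω) :=
    hsm.continuousOn.comp_continuous (R.continuous.comp continuous_subtype_val)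
      (fun ω => by simpa using hne ω)
  set q : sphere (0 : Esp n) 1 → ℝ := fun ω => h (R ω) / h ω - 1 with hq
  have hqc : Continuous q := (hhRc.div hhc fun ω => (hpos ω ω.2).ne').sub continuous_const
  obtain ⟨C0, hC0⟩ := (isCompact_range hhc).bddAbove
  obtain ⟨Q0, hQ0⟩ := (isCompact_range hqc.abs).bddAbove
  have hmain : ∀ t : ℝ, 0 ≤ t → t ≤ 1 → ∫ ω : sphere (0 : Esp n) 1, G ω
      ∂(volume : Measure (Esp n)).toSphere ≤
      ∫ ω : sphere (0 : Esp n) 1, G ω * (1 + t * q ω) ^ (n + 1)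
        ∂(volume : Measure (Esp n)).toSphere := by
    intro t ht ht1
    have hkpos : ∀ x ∈ sphere (0 : Esp n) 1, 0 < (1 - t) * h x + t * h (R x) := by
      intro x hx
      have p1 := hpos x hx
      have p2 := hpos _ (hRs ⟨x, hx⟩)
      rcases ht.eq_or_lt with rfl | h3
      · simpa using p1
      · have := mul_nonneg (sub_nonneg.2 ht1) p1.le
        have := mul_pos h3 p2
        simp only at this
        linarith
    have h1 := vol_lower hsm hhom hconv hpos hG hGc
    have h2 := steiner (h := h) (C := max C0 0) (fun w hw => le_max_of_le_left
      (hC0 ⟨⟨w, by simpa using hw⟩, rfl⟩)) (le_max_right _ _) e he R hRR hRe hRp ht ht1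
    have h3 := vol_upper hsm hhom hpos hG hGc hhc (k := fun w => (1 - t) * h w + t * h (R w))
      ((continuous_const.mul hhc).add (continuous_const.mul hhRc)) hkpos
    have h4 := h1.trans (h2.trans h3)
    have e1 : ∀ ω : sphere (0 : Esp n) 1, ((1 - t) * h ω + t * h (R ω)) / h ω = 1 + t * q ω := by
      intro ω
      have := (hpos ω ω.2).ne'
      simp only [hq]; field_simp; ring
    simp only [e1] at h4
    have hb : ∀ ω, 0 < 1 + t * q ω := fun ω => by
      rw [← e1]; exact div_pos (hkpos ω ω.2) (hpos ω ω.2)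
    have e2 : ∀ ω : sphere (0 : Esp n) 1, ENNReal.ofReal (G ω) *
        ENNReal.ofReal ((1 + t * q ω) ^ (n + 1) / (n + 1)) =
        ENNReal.ofReal (G ω * (1 + t * q ω) ^ (n + 1) / (n + 1)) := by
      intro ω
      rw [← ENNReal.ofReal_mul (hG0 ω).le, mul_div_assoc]
    have e3 : ∀ ω : sphere (0 : Esp n) 1, ENNReal.ofReal (G ω) *
        ENNReal.ofReal ((1 : ℝ) ^ (n + 1) / (n + 1)) = ENNReal.ofReal (G ω / (n + 1)) := by
      intro ω
      rw [← ENNReal.ofReal_mul (hG0 ω).le, one_pow, mul_one_div]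
    simp only [e2, e3] at h4
    have c2 : Continuous fun ω : sphere (0 : Esp n) 1 => G ω * (1 + t * q ω) ^ (n + 1) :=
      hGc.mul ((continuous_const.add (continuous_const.mul hqc)).pow _)
    rw [← ofReal_integral_eq_lintegral_ofReal (cont_int (hGc.div_const _))
        (Filter.Eventually.of_forall fun ω => (div_pos (hG0 ω) (by positivity)).le),
      ← ofReal_integral_eq_lintegral_ofReal (cont_int (c2.div_const _))
        (Filter.Eventually.of_forall fun ω => (div_pos (mul_pos (hG0 ω) (pow_pos (hb ω) _))
          (by positivity)).le), ENNReal.ofReal_le_ofReal_iff (integral_nonneg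
        fun ω => (div_pos (mul_pos (hG0 ω) (pow_pos (hb ω) _)) (by positivity)).le),
      integral_div, integral_div, div_le_div_iff_of_pos_right (by positivity)] at h4
    exact h4
  obtain ⟨C, hC, hbd⟩ := pow_bound (n + 1) (max Q0 0) (le_max_right _ _)
  set I := ∫ ω : sphere (0 : Esp n) 1, G ω * q ω ∂(volume : Measure (Esp n)).toSphere with hI
  set V := ∫ ω : sphere (0 : Esp n) 1, G ω ∂(volume : Measure (Esp n)).toSphere with hV
  have hV0 : 0 ≤ V := integral_nonneg fun ω => (hG0 ω).le
  have hlin : ∀ t : ℝ, 0 < t → t ≤ 1 → 0 ≤ (n + 1) * I + C * V * t := by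
    intro t ht ht1
    have h1 := hmain t ht.le ht1
    have c1 : Continuous fun ω : sphere (0 : Esp n) 1 => G ω * q ω := hGc.mul hqc
    have h2 : ∫ ω : sphere (0 : Esp n) 1, G ω * (1 + t * q ω) ^ (n + 1)
        ∂(volume : Measure (Esp n)).toSphere ≤ ∫ ω : sphere (0 : Esp n) 1,
        ((1 + C * t ^ 2) * G ω + ((n + 1) * t) * (G ω * q ω))
        ∂(volume : Measure (Esp n)).toSphere := by
      refine integral_mono (cont_int
        (hGc.mul ((continuous_const.add (continuous_const.mul hqc)).pow _)))
        (cont_int ((continuous_const.mul hGc).add (continuous_const.mul c1))) fun ω => ?_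
      have h3 := (abs_le.1 (hbd t (q ω) ht.le ht1 (le_max_of_le_left (hQ0 ⟨ω, rfl⟩)))).2
      push_cast at h3
      have h4 := mul_le_mul_of_nonneg_left h3 (hG0 ω).le
      show G ω * (1 + t * q ω) ^ (n + 1) ≤ (1 + C * t ^ 2) * G ω + ((n + 1) * t) * (G ω * q ω)
      linarith
    rw [integral_add ((cont_int hGc).const_mul _) ((cont_int c1).const_mul _),
      integral_const_mul, integral_const_mul, ← hI, ← hV] at h2
    have h5 : 0 ≤ t * ((n + 1) * I + C * V * t) := by linarith
    exact nonneg_of_mul_nonneg_right h5 ht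
  by_contra hneg
  push Not at hneg
  have hCV : 0 ≤ C * V := mul_nonneg hC hV0
  have hn1 : (0 : ℝ) < n + 1 := by positivity
  have hJ : 0 < -((n + 1) * I) := by nlinarith
  set J := -((n + 1) * I) with hJd
  set t := min 1 (J / (2 * (C * V + 1))) with ht
  have htp : 0 < t := lt_min one_pos (by positivity)
  have h6 := hlin t htp (min_le_left _ _)
  have h7 : t ≤ J / (2 * (C * V + 1)) := min_le_right _ _
  rw [le_div_iff₀ (by positivity)] at h7
  nlinarith
end Main

/-- isotropic Orlicz–Minkowski problem.  Let `φ : (0,∞) → (0,∞)` be `C¹`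
with `φ' > 0`.  If `Mⁿ ⊆ ℝ^{n+1}` is a closed, smooth, strictly convex hypersurface with
support function `h > 0` and Gauss curvature `𝒦` satisfying `φ(h) 𝒦 = 1` on `𝕊ⁿ`, then `M`
is an origin-centred sphere. -/
theorem statement_4 (n : ℕ) (hn : 1 ≤ n)
    (φ : ℝ → ℝ)
    (hφC1 : ContDiffOn ℝ 1 φ (Set.Ioi 0))
    (hφpos : ∀ x : ℝ, 0 < x → 0 < φ x)
    (hφ' : ∀ x : ℝ, 0 < x → 0 < deriv φ x)
    (h 𝒦 : Esp n → ℝ)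
    (hsm : ContDiffOn ℝ (⊤ : ℕ∞) h {(0 : Esp n)}ᶜ)
    (hhom : PosHom n h)
    (hconv : ∀ x ∈ sphere (0 : Esp n) 1, ∀ v : Esp n,
      ⟪v, x⟫ = 0 → v ≠ 0 → 0 < hessForm n h x v v)
    (hpos : ∀ x ∈ sphere (0 : Esp n) 1, 0 < h x)
    (hGauss : ∀ x ∈ sphere (0 : Esp n) 1, (𝒦 x)⁻¹ = sigmaElem n n h x)
    (heq : ∀ x ∈ sphere (0 : Esp n) 1, φ (h x) * 𝒦 x = 1) :
    ∃ r : ℝ, 0 < r ∧ ∀ x ∈ sphere (0 : Esp n) 1, h x = r := by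
  have hne : ∀ ω : sphere (0 : Esp n) 1, (ω : Esp n) ≠ 0 := fun ω h0 => by
    have := ω.2; simp [h0] at this
  have hhc : Continuous fun ω : sphere (0 : Esp n) 1 => h ω :=
    hsm.continuousOn.comp_continuous continuous_subtype_val hne
  have hφh : ∀ {f : sphere (0 : Esp n) 1 → ℝ}, Continuous f → (∀ ω, 0 < f ω) →
      Continuous fun ω => φ (f ω) := fun hf hf0 =>
    hφC1.continuousOn.comp_continuous hf hf0
  have hmono : StrictMonoOn φ (Set.Ioi 0) :=
    strictMonoOn_of_deriv_pos (convex_Ioi 0) hφC1.continuousOn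
      (by rw [interior_Ioi]; exact fun x hx => hφ' x hx)
  have hsig : ∀ x ∈ sphere (0 : Esp n) 1, sigmaElem n n h x = φ (h x) := by
    intro x hx
    rw [← hGauss x hx]
    exact inv_eq_of_mul_eq_one_left (heq x hx)
  set G : Esp n → ℝ := fun x => h x * φ (h x) with hGdef
  have hG0 : ∀ ω : sphere (0 : Esp n) 1, 0 < G ω := fun ω =>
    mul_pos (hpos ω ω.2) (hφpos _ (hpos ω ω.2))
  have hGc : Continuous fun ω : sphere (0 : Esp n) 1 => G ω :=
    hhc.mul (hφh hhc fun ω => hpos ω ω.2)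
  have hG : ∀ x : Esp n, x ≠ 0 → |(fderiv ℝ (Psi h) x).det| = G (‖x‖⁻¹ • x) := by
    intro x hx
    have hxp : 0 < ‖x‖ := norm_pos_iff.2 hx
    have hu := norm_unit hx
    have hus : ‖x‖⁻¹ • x ∈ sphere (0 : Esp n) 1 := by simpa using hu
    rw [← fderiv_hom (Psi_hom hhom) (inv_pos.2 hxp) x, Psi_det hsm hhom hu (hpos _ hus),
      hsig _ hus, abs_of_pos (hG0 ⟨_, hus⟩)]
  have hall : ∀ x ∈ sphere (0 : Esp n) 1, ∀ y ∈ sphere (0 : Esp n) 1, h x = h y := by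
    intro x hx y hy
    by_cases hxy : x = y
    · rw [hxy]
    have hd : x - y ≠ 0 := sub_ne_zero.2 hxy
    set d := x - y with hddef
    set R := Submodule.reflection (ℝ ∙ d)ᗮ with hR
    have hRx : R x = y := Submodule.reflection_sub (by
      rw [mem_sphere_zero_iff_norm.1 hx, mem_sphere_zero_iff_norm.1 hy])
    have hRR : ∀ z, R (R z) = z := fun z => Submodule.reflection_reflection _ z
    have hdp : 0 < ‖d‖ := norm_pos_iff.2 hd
    have hRd : R d = -d := Submodule.reflection_orthogonalComplement_singleton_eq_neg d
    have hRe : R (‖d‖⁻¹ • d) = -(‖d‖⁻¹ • d) := by rw [map_smul, hRd, smul_neg]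
    have hRp : ∀ p, ⟪p, ‖d‖⁻¹ • d⟫ = 0 → R p = p := by
      intro p hp
      apply Submodule.reflection_mem_subspace_eq_self
      rw [Submodule.mem_orthogonal_singleton_iff_inner_left]
      rw [real_inner_smul_right] at hp
      exact (mul_eq_zero.1 hp).resolve_left (inv_pos.2 hdp).ne'
    have hfv := first_var hsm hhom hconv hpos hG hG0 hGc _ (norm_unit hd) R hRR hRe hRp
    have hRs : ∀ ω : sphere (0 : Esp n) 1, R ω ∈ sphere (0 : Esp n) 1 := fun ω => by simp
    have hhRc : Continuous fun ω : sphere (0 : Esp n) 1 => h (R ω) :=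
      hsm.continuousOn.comp_continuous (R.continuous.comp continuous_subtype_val)
        (fun ω => by simpa using hne ω)
    set f1 : sphere (0 : Esp n) 1 → ℝ := fun ω => φ (h ω) * (h (R ω) - h ω) with hf1
    set f2 : sphere (0 : Esp n) 1 → ℝ := fun ω => φ (h (R ω)) * (h ω - h (R ω)) with hf2
    have cf1 : Continuous f1 := (hφh hhc fun ω => hpos ω ω.2).mul (hhRc.sub hhc)
    have cf2 : Continuous f2 := (hφh hhRc fun ω => hpos _ (hRs ω)).mul (hhc.sub hhRc)
    have i1 : 0 ≤ ∫ ω, f1 ω ∂(volume : Measure (Esp n)).toSphere := by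
      refine hfv.trans (le_of_eq (integral_congr_ae (Filter.Eventually.of_forall fun ω => ?_)))
      have := (hpos ω ω.2).ne'
      simp only [hGdef, hf1]
      field_simp
    have hS := toSphere_map R (fun ω => ⟨R ω, hRs ω⟩) (fun ω => rfl)
    have i2 : ∫ ω, f2 ω ∂(volume : Measure (Esp n)).toSphere =
        ∫ ω, f1 ω ∂(volume : Measure (Esp n)).toSphere := by
      conv_rhs => rw [← hS.map_eq]
      rw [integral_map hS.measurable.aemeasurable cf1.aestronglyMeasurable]
      refine integral_congr_ae (Filter.Eventually.of_forall fun ω => ?_)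
      simp only [hf1, hf2, hRR]
    have cF : Continuous fun ω => -(f1 ω + f2 ω) := (cf1.add cf2).neg
    have hF : ∀ ω : sphere (0 : Esp n) 1,
        -(f1 ω + f2 ω) = (φ (h (R ω)) - φ (h ω)) * (h (R ω) - h ω) := by
      intro ω; simp only [hf1, hf2]; ring
    by_contra hcon
    have hpz : 0 < ∫ ω, -(f1 ω + f2 ω) ∂(volume : Measure (Esp n)).toSphere := by
      refine cF.integral_pos_of_hasCompactSupport_nonneg_nonzero
        (HasCompactSupport.of_compactSpace _) (fun ω => ?_) (x := ⟨x, hx⟩) ?_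
      · show 0 ≤ -(f1 ω + f2 ω)
        rw [hF]
        rcases le_total (h ω) (h (R ω)) with hle | hle
        · exact mul_nonneg (sub_nonneg.2 (hmono.monotoneOn (hpos ω ω.2) (hpos _ (hRs ω)) hle))
            (sub_nonneg.2 hle)
        · exact mul_nonneg_of_nonpos_of_nonpos
            (sub_nonpos.2 (hmono.monotoneOn (hpos _ (hRs ω)) (hpos ω ω.2) hle))
            (sub_nonpos.2 hle)
      · rw [hF]
        show (φ (h (R x)) - φ (h x)) * (h (R x) - h x) ≠ 0
        rw [hRx]
        refine mul_ne_zero (sub_ne_zero.2 fun h0 => hcon ?_) (sub_ne_zero.2 fun h0 => hcon h0.symm)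
        exact (hmono.injOn (hpos y hy) (hpos x hx) h0).symm
    rw [integral_neg, integral_add (cont_int cf1) (cont_int cf2), i2] at hpz
    linarith
  have he : (EuclideanSpace.single 0 1 : Esp n) ∈ sphere (0 : Esp n) 1 := by simp
  exact ⟨h (EuclideanSpace.single 0 1), hpos _ he, fun x hx => hall x hx _ he⟩
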